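/- For n≥1, assuming [B_δ, B_{kδ}] = 0 for all k < n, then for all m ≤ n+2 the element C_m admits the ordered expression C_m = −Σ_{p=1}^{⌊(m−1)/2⌋} q^{−2(p−1)} B_{(m−2p)δ} + Σ_{p=1}^{⌊m/2⌋} a_p^m B_{(m−p−1)δ+α_1} B_{(p−1)δ+α_1}, where a_p^m = q^{−2(p−1)}(1+q^{−2}) for 1 ≤ p ≤ ⌊(m−1)/2⌋ and a_{m/2}^m = q^{−m+2} when m is even. -/

import Mathlib

set_option synthInstance.maxHeartbeats 1000000
set_option maxHeartbeats 1000000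

noncomputable section

open scoped BigOperators

/-- The field `ℚ(q)` of rational functions. -/
abbrev KK : Type := RatFunc ℚ

/-- The indeterminate `q ∈ ℚ(q)`. -/
def qq : KK := RatFunc.X

/-- The `q`-Dolan–Grady relations defining the `q`-Onsager algebra `B_c`:
`Σᵢ (−1)ⁱ [3 choose i]_q B₀^{3−i} B₁ B₀^i = −qc(q+q⁻¹)²(B₀B₁ − B₁B₀)` and the
same with `B₀, B₁` interchanged (here `[3 choose 1]_q = [3 choose 2]_q = q² + 1 + q⁻²`). -/
inductive qOnsRel (c : KK) : FreeAlgebra KK (Fin 2) → FreeAlgebra KK (Fin 2) → Prop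
  | r0 : qOnsRel c
      (FreeAlgebra.ι KK (0 : Fin 2) ^ 3 * FreeAlgebra.ι KK (1 : Fin 2)
        - (qq ^ 2 + 1 + (qq⁻¹) ^ 2) • (FreeAlgebra.ι KK (0 : Fin 2) ^ 2 * FreeAlgebra.ι KK (1 : Fin 2) * FreeAlgebra.ι KK (0 : Fin 2))
        + (qq ^ 2 + 1 + (qq⁻¹) ^ 2) • (FreeAlgebra.ι KK (0 : Fin 2) * FreeAlgebra.ι KK (1 : Fin 2) * FreeAlgebra.ι KK (0 : Fin 2) ^ 2)
        - FreeAlgebra.ι KK (1 : Fin 2) * FreeAlgebra.ι KK (0 : Fin 2) ^ 3)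
      ((-(qq * c * (qq + qq⁻¹) ^ 2)) •
        (FreeAlgebra.ι KK (0 : Fin 2) * FreeAlgebra.ι KK (1 : Fin 2) - FreeAlgebra.ι KK (1 : Fin 2) * FreeAlgebra.ι KK (0 : Fin 2)))
  | r1 : qOnsRel c
      (FreeAlgebra.ι KK (1 : Fin 2) ^ 3 * FreeAlgebra.ι KK (0 : Fin 2)
        - (qq ^ 2 + 1 + (qq⁻¹) ^ 2) • (FreeAlgebra.ι KK (1 : Fin 2) ^ 2 * FreeAlgebra.ι KK (0 : Fin 2) * FreeAlgebra.ι KK (1 : Fin 2))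
        + (qq ^ 2 + 1 + (qq⁻¹) ^ 2) • (FreeAlgebra.ι KK (1 : Fin 2) * FreeAlgebra.ι KK (0 : Fin 2) * FreeAlgebra.ι KK (1 : Fin 2) ^ 2)
        - FreeAlgebra.ι KK (0 : Fin 2) * FreeAlgebra.ι KK (1 : Fin 2) ^ 3)
      ((-(qq * c * (qq + qq⁻¹) ^ 2)) •
        (FreeAlgebra.ι KK (1 : Fin 2) * FreeAlgebra.ι KK (0 : Fin 2) - FreeAlgebra.ι KK (0 : Fin 2) * FreeAlgebra.ι KK (1 : Fin 2)))

/-- The `q`-Onsager algebra `B_c`. -/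
abbrev QOns (c : KK) : Type := RingQuot (qOnsRel c)

/-- The generator `B₀` of `B_c`. -/
def Bo (c : KK) : QOns c := RingQuot.mkAlgHom KK (qOnsRel c) (FreeAlgebra.ι KK (0 : Fin 2))

/-- The generator `B₁` of `B_c`. -/
def Bi (c : KK) : QOns c := RingQuot.mkAlgHom KK (qOnsRel c) (FreeAlgebra.ι KK (1 : Fin 2))

/-- `B_δ = −B₀B₁ + q⁻²B₁B₀`. -/
def Bdel (c : KK) : QOns c := -(Bo c * Bi c) + ((qq⁻¹) ^ 2) • (Bi c * Bo c)

/-- `B̃_δ = −B₁B₀ + q⁻²B₀B₁`. -/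
def tBdel (c : KK) : QOns c := -(Bi c * Bo c) + ((qq⁻¹) ^ 2) • (Bo c * Bi c)

/-- The formula for `T₀(B₁)`:
`(1/(q²[2]_q c))(B₁B₀² − q[2]_q B₀B₁B₀ + q²B₀²B₁) + B₁`. -/
def T0B1val (c : KK) : QOns c :=
  (qq ^ 2 * (qq + qq⁻¹) * c)⁻¹ •
    (Bi c * Bo c ^ 2 - (qq * (qq + qq⁻¹)) • (Bo c * Bi c * Bo c) + qq ^ 2 • (Bo c ^ 2 * Bi c))
    + Bi c

/-- The formula for `T₀⁻¹(B₁)`: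
`(1/(q²[2]_q c))(B₀²B₁ − q[2]_q B₀B₁B₀ + q²B₁B₀²) + B₁`. -/
def T0invB1val (c : KK) : QOns c :=
  (qq ^ 2 * (qq + qq⁻¹) * c)⁻¹ •
    (Bo c ^ 2 * Bi c - (qq * (qq + qq⁻¹)) • (Bo c * Bi c * Bo c) + qq ^ 2 • (Bi c * Bo c ^ 2))
    + Bi c

/-- `T₁ = Φ ∘ T₀ ∘ Φ`. -/
def T1def (c : KK) (Φ T0 : QOns c ≃ₐ[KK] QOns c) : QOns c ≃ₐ[KK] QOns c :=
  Φ.trans (T0.trans Φ)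

/-- The real root vectors `B_{nδ+α₀} = (T₀Φ)ⁿ(B₀)` for `n ≥ 0`. -/
def Ba0 (c : KK) (Φ T0 : QOns c ≃ₐ[KK] QOns c) (n : ℕ) : QOns c :=
  ((⇑T0 ∘ ⇑Φ)^[n]) (Bo c)

/-- The real root vectors `B_{nδ+α₁} = (T₁⁻¹Φ)ⁿ(B₁)` for `n ≥ 0`. -/
def Ba1 (c : KK) (Φ T0 : QOns c ≃ₐ[KK] QOns c) (n : ℕ) : QOns c :=
  ((⇑(T1def c Φ T0).symm ∘ ⇑Φ)^[n]) (Bi c)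

/-- `B_{kδ+α₁}` for `k ∈ ℤ`, with the convention `B_{kδ+α₁} = B_{(−k−1)δ+α₀}` for `k < 0`. -/
def Ba1Z (c : KK) (Φ T0 : QOns c ≃ₐ[KK] QOns c) (k : ℤ) : QOns c :=
  if 0 ≤ k then Ba1 c Φ T0 k.toNat else Ba0 c Φ T0 (-k - 1).toNat

/-- `B_{kδ+α₀}` for `k ∈ ℤ`, with the convention `B_{kδ+α₀} = B_{(−k−1)δ+α₁}` for `k < 0`. -/
def Ba0Z (c : KK) (Φ T0 : QOns c ≃ₐ[KK] QOns c) (k : ℤ) : QOns c :=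
  if 0 ≤ k then Ba0 c Φ T0 k.toNat else Ba1 c Φ T0 (-k - 1).toNat

/-- `C_m = Σ_{p=0}^{m−2} B_{pδ+α₁} B_{(m−p−2)δ+α₁}` (so `C₀ = C₁ = 0`). -/
def CC (c : KK) (Φ T0 : QOns c ≃ₐ[KK] QOns c) (m : ℕ) : QOns c :=
  ∑ p ∈ Finset.range (m - 1), Ba1 c Φ T0 p * Ba1 c Φ T0 (m - 2 - p)

/-- The imaginary root vectors
`B_{mδ} = −B₀B_{(m−1)δ+α₁} + q⁻²B_{(m−1)δ+α₁}B₀ + (q⁻²−1)C_m` for `m ≥ 1`. -/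
def Bim (c : KK) (Φ T0 : QOns c ≃ₐ[KK] QOns c) (m : ℕ) : QOns c :=
  -(Bo c * Ba1 c Φ T0 (m - 1)) + ((qq⁻¹) ^ 2) • (Ba1 c Φ T0 (m - 1) * Bo c)
    + (((qq⁻¹) ^ 2 - 1)) • CC c Φ T0 m



/-- Symmetric sums of products, `SS y a m = Σ_{i<m} y_{a+i} y_{a+m-1-i}`, defined recursively. -/
def SS {A : Type*} [Ring A] (y : ℕ → A) : ℕ → ℕ → A
  | _, 0 => 0
  | a, 1 => y a * y a
  | a, (m + 2) => y a * y (a + m + 1) + y (a + m + 1) * y a + SS y (a + 1) m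

theorem SS_eq_sum {A : Type*} [Ring A] (y : ℕ → A) : ∀ (m a : ℕ),
    SS y a m = ∑ p ∈ Finset.range m, y (a + p) * y (a + (m - 1 - p))
  | 0, a => by simp [SS]
  | 1, a => by simp [SS]
  | (m + 2), a => by
    rw [SS, SS_eq_sum y m (a + 1), Finset.sum_range_succ, Finset.sum_range_succ']
    have : ∀ p ∈ Finset.range m, y (a + (p + 1)) * y (a + (m + 2 - 1 - (p + 1)))
        = y (a + 1 + p) * y (a + 1 + (m - 1 - p)) := by
      intro p hp
      rw [Finset.mem_range] at hp
      congr 2 <;> omega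
    rw [Finset.sum_congr rfl this]
    have e1 : a + (m + 2 - 1 - 0) = a + m + 1 := by omega
    have e2 : a + (m + 2 - 1 - (m + 1)) = a := by omega
    rw [e1, e2]
    simp only [add_zero, ← add_assoc]
    abel

section core
variable {K A : Type*} [Field K] [Ring A] [Algebra K A]

/-- The shifted imaginary root vectors. -/
def GG (v : K) (y : ℕ → A) (a m : ℕ) : A :=
  -(y a * y (a + m + 1)) + v • (y (a + m + 1) * y a) + (v - 1) • SS y (a + 1) m

theorem ad_mul (D x z : A) : D * (x * z) - (x * z) * D = (D * x - x * D) * z + x * (D * z - z * D) := by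
  noncomm_ring

theorem ad_SS (D : A) (l : K) (y : ℕ → A)
    (h : ∀ n, D * y (n + 1) - y (n + 1) * D = l • (y (n + 2) - y n)) : ∀ (m a : ℕ),
    D * SS y (a + 1) (m + 1) - SS y (a + 1) (m + 1) * D =
      l • (SS y (a + 1) (m + 2) + SS y (a + 2) m - SS y a (m + 2) - SS y (a + 1) m)
  | 0, a => by
    simp only [SS, ad_mul, h, smul_mul_assoc, mul_smul_comm, mul_sub, sub_mul, add_zero]
    module
  | 1, a => by
    have h1 := h a
    have h2 := h (a + 1)
    simp only [SS, add_zero, mul_add D, add_mul _ _ D]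
    have e1 := ad_mul D (y (a + 1)) (y (a + 1 + 1))
    have e2 := ad_mul D (y (a + 1 + 1)) (y (a + 1))
    rw [h1, h2] at e1 e2
    simp only [smul_mul_assoc, mul_smul_comm, mul_sub, sub_mul, add_assoc, Nat.reduceAdd] at e1 e2 ⊢
    linear_combination (norm := module) e1 + e2
  | (m + 2), a => by
    have ih := ad_SS D l y h m (a + 1)
    have h1 := h a
    have h2 := h (a + m + 2)
    have e1 := ad_mul D (y (a + 1)) (y (a + m + 3))
    have e2 := ad_mul D (y (a + m + 3)) (y (a + 1))
    have E : ∀ b k, SS y b (k + 2) = y b * y (b + k + 1) + y (b + k + 1) * y b + SS y (b + 1) k :=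
      fun b k => by rw [SS]
    rw [show m + 2 + 1 = (m + 1) + 2 from rfl, E (a + 1) (m + 1), E (a + 1) (m + 2),
      E (a + 2) m, E a (m + 2), E (a + 1) m, mul_add D, add_mul _ _ D, mul_add D, add_mul _ _ D]
    rw [h1, show a + m + 3 = a + m + 2 + 1 from rfl, h2] at e1 e2
    rw [show a + 1 + 1 = a + 2 from rfl, E (a + 2) m, E (a + 1) m] at ih
    simp only [smul_mul_assoc, mul_smul_comm, mul_sub, sub_mul] at e1 e2
    ring_nf at e1 e2 ih ⊢
    linear_combination (norm := module) e1 + e2 + ih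

theorem ad_GG_zero (v : K) (D : A) (l : K) (y : ℕ → A)
    (h : ∀ n, D * y (n + 1) - y (n + 1) * D = l • (y (n + 2) - y n)) (a : ℕ) :
    D * GG v y (a + 1) 0 - GG v y (a + 1) 0 * D =
      l • (GG v y (a + 1) 1 - GG v y a 1) := by
  have e1 := ad_mul D (y (a + 1)) (y (a + 2))
  have e2 := ad_mul D (y (a + 2)) (y (a + 1))
  rw [h a, h (a + 1)] at e1 e2
  simp only [GG, SS, mul_add D, add_mul _ _ D, mul_neg, neg_mul, smul_mul_assoc, mul_smul_comm,
    mul_sub, sub_mul, add_zero, smul_zero, add_assoc, Nat.reduceAdd] at e1 e2 ⊢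
  linear_combination (norm := module) v • e2 - e1

theorem ad_GG_succ (v : K) (D : A) (l : K) (y : ℕ → A)
    (h : ∀ n, D * y (n + 1) - y (n + 1) * D = l • (y (n + 2) - y n)) (a m : ℕ) :
    D * GG v y (a + 1) (m + 1) - GG v y (a + 1) (m + 1) * D =
      l • (GG v y (a + 1) (m + 2) - GG v y a (m + 2) + GG v y (a + 2) m - GG v y (a + 1) m) := by
  have e1 := ad_mul D (y (a + 1)) (y (a + m + 3))
  have e2 := ad_mul D (y (a + m + 3)) (y (a + 1))
  have e3 := ad_SS D l y h m (a + 1)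
  rw [h a, show a + m + 3 = a + m + 2 + 1 from rfl, h (a + m + 2)] at e1 e2
  have i1 : a + 1 + (m + 1) + 1 = a + m + 2 + 1 := by omega
  have i2 : a + 1 + (m + 2) + 1 = a + m + 2 + 2 := by omega
  have i3 : a + (m + 2) + 1 = a + m + 2 + 1 := by omega
  have i4 : a + 2 + m + 1 = a + m + 2 + 1 := by omega
  have i5 : a + 1 + m + 1 = a + m + 2 := by omega
  have i6 : a + 1 + 1 = a + 2 := by omega
  have i7 : a + 1 + 2 = a + 2 + 1 := by omega
  simp only [GG, mul_add D, add_mul _ _ D, mul_neg, neg_mul, smul_mul_assoc, mul_smul_comm,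
    mul_sub, sub_mul, i1, i2, i3, i4, i5, i6, i7] at e1 e2 e3 ⊢
  linear_combination (norm := module) v • e2 - e1 + (v - 1) • e3

theorem map_SS (g : A →ₐ[K] A) (y : ℕ → A) (hg : ∀ n, g (y n) = y (n + 1)) : ∀ (m a : ℕ),
    g (SS y a m) = SS y (a + 1) m
  | 0, a => by simp [SS]
  | 1, a => by simp [SS, hg]
  | (m + 2), a => by
    simp only [SS, map_add, map_mul, hg, map_SS g y hg m]
    ring_nf

theorem map_GG (v : K) (g : A →ₐ[K] A) (y : ℕ → A) (hg : ∀ n, g (y n) = y (n + 1)) (m a : ℕ) :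
    g (GG v y a m) = GG v y (a + 1) m := by
  simp only [GG, map_add, map_mul, map_neg, map_smul, hg, map_SS g y hg]
  rw [show a + 1 + m + 1 = a + m + 1 + 1 by omega]

theorem GG_shift (v : K) (g : A →ₐ[K] A) (y : ℕ → A) (hg : ∀ n, g (y n) = y (n + 1))
    (m : ℕ) (h : GG v y 1 m = GG v y 0 m) : ∀ a, GG v y a m = GG v y 0 m
  | 0 => rfl
  | a + 1 => by
    rw [← map_GG v g y hg, GG_shift v g y hg m h a, map_GG v g y hg, h]

theorem GG_inv (v : K) (g : A →ₐ[K] A) (D : A) (l : K) (hl : l ≠ 0) (y : ℕ → A)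
    (hg : ∀ n, g (y n) = y (n + 1)) (hD : GG v y 0 0 = D) (hgD : g D = D)
    (h : ∀ n, D * y (n + 1) - y (n + 1) * D = l • (y (n + 2) - y n)) (n : ℕ)
    (hcom : ∀ k, k + 1 < n → D * GG v y 0 k - GG v y 0 k * D = 0) :
    ∀ k, k < n → ∀ a, GG v y a k = GG v y 0 k
  | 0, _ => GG_shift v g y hg 0 (by rw [← map_GG v g y hg, hD, hgD])
  | 1, hk => GG_shift v g y hg 1 (by
      have e := ad_GG_zero v D l y h 0
      rw [GG_inv v g D l hl y hg hD hgD h n hcom 0 (by omega) (0 + 1), hD, sub_self] at e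
      have := (smul_eq_zero.mp e.symm).resolve_left hl
      exact sub_eq_zero.mp this)
  | k + 2, hk => GG_shift v g y hg (k + 2) (by
      have e := ad_GG_succ v D l y h 0 k
      rw [GG_inv v g D l hl y hg hD hgD h n hcom (k + 1) (by omega) (0 + 1),
        hcom (k + 1) (by omega),
        GG_inv v g D l hl y hg hD hgD h n hcom k (by omega) (0 + 1),
        GG_inv v g D l hl y hg hD hgD h n hcom k (by omega) (0 + 2)] at e
      have := (smul_eq_zero.mp e.symm).resolve_left hl
      rw [add_sub_cancel_right] at this
      exact sub_eq_zero.mp this)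

theorem SS_ordered (w : K) (y : ℕ → A) (n : ℕ)
    (hG : ∀ k, k < n → ∀ a, GG (w ^ 2) y a k = GG (w ^ 2) y 0 k) : ∀ m, m ≤ n + 1 → ∀ a,
    SS y (a + 1) m = -(∑ i ∈ Finset.range (m / 2), w ^ (2 * i) • GG (w ^ 2) y 0 (m - 2 * i - 2))
      + ∑ i ∈ Finset.range ((m + 1) / 2),
        (if 2 * i + 1 = m then w ^ (m - 1) else w ^ (2 * i) * (1 + w ^ 2)) •
          (y (a + m - i) * y (a + i + 1))
  | 0, _, a => by simp [SS]
  | 1, _, a => by simp [SS]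
  | m + 2, hm, a => by
    have ih := SS_ordered w y n hG m (by omega) (a + 1)
    have hGm := hG m (by omega) (a + 1)
    rw [show (m + 2) / 2 = m / 2 + 1 by omega, show (m + 2 + 1) / 2 = (m + 1) / 2 + 1 by omega,
      Finset.sum_range_succ', Finset.sum_range_succ']
    have e1 : ∑ i ∈ Finset.range (m / 2),
        w ^ (2 * (i + 1)) • GG (w ^ 2) y 0 (m + 2 - 2 * (i + 1) - 2)
        = w ^ 2 • ∑ i ∈ Finset.range (m / 2), w ^ (2 * i) • GG (w ^ 2) y 0 (m - 2 * i - 2) := by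
      rw [Finset.smul_sum]
      refine Finset.sum_congr rfl fun i _ => ?_
      rw [show m + 2 - 2 * (i + 1) - 2 = m - 2 * i - 2 by omega, smul_smul]
      ring_nf
    have e2 : ∑ i ∈ Finset.range ((m + 1) / 2),
        (if 2 * (i + 1) + 1 = m + 2 then w ^ (m + 2 - 1)
          else w ^ (2 * (i + 1)) * (1 + w ^ 2)) •
          (y (a + (m + 2) - (i + 1)) * y (a + (i + 1) + 1))
        = w ^ 2 • ∑ i ∈ Finset.range ((m + 1) / 2),
        (if 2 * i + 1 = m then w ^ (m - 1) else w ^ (2 * i) * (1 + w ^ 2)) •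
          (y (a + 1 + m - i) * y (a + 1 + i + 1)) := by
      rw [Finset.smul_sum]
      refine Finset.sum_congr rfl fun i hi => ?_
      rw [Finset.mem_range] at hi
      rw [show a + (m + 2) - (i + 1) = a + 1 + m - i by omega,
        show a + (i + 1) + 1 = a + 1 + i + 1 by omega, smul_smul]
      congr 1
      by_cases hc : 2 * i + 1 = m
      · rw [if_pos hc, if_pos (by omega), ← pow_add]
        congr 1
        omega
      · rw [if_neg hc, if_neg (by omega)]
        ring
    rw [e1, e2]
    have hif : (if 2 * 0 + 1 = m + 2 then w ^ (m + 2 - 1) else w ^ (2 * 0) * (1 + w ^ 2))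
        = 1 + w ^ 2 := by
      rw [if_neg (by omega)]
      simp
    rw [hif, show m + 2 - 2 * 0 - 2 = m by omega, ← hGm]
    rw [GG]
    simp only [SS, mul_zero, pow_zero, one_smul, Nat.sub_zero, add_zero]
    rw [show a + (m + 2) = a + 1 + m + 1 by omega]
    linear_combination (norm := module) (w ^ 2) • ih

end core

theorem qq_ne_zero : qq ≠ 0 := RatFunc.X_ne_zero

theorem qq_add_inv_ne_zero : qq + qq⁻¹ ≠ 0 := by
  intro h
  have h0 := qq_ne_zero
  have h2 : qq ^ 2 + 1 = 0 := by
    have : qq * (qq + qq⁻¹) = 0 := by rw [h, mul_zero]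
    rw [mul_add, mul_inv_cancel₀ h0] at this
    rw [← this]; ring
  have h3 : algebraMap (Polynomial ℚ) (RatFunc ℚ) (Polynomial.X ^ 2 + 1) = 0 := by
    rw [map_add, map_pow, RatFunc.algebraMap_X, map_one]
    exact h2
  have h4 : (Polynomial.X ^ 2 + 1 : Polynomial ℚ) = 0 :=
    (map_eq_zero_iff _ (RatFunc.algebraMap_injective ℚ)).mp h3
  have h5 := congrArg (Polynomial.eval 0) h4
  simp at h5

/-- The first q-Dolan-Grady relation. -/
theorem DG0 (c : KK) : Bo c ^ 3 * Bi c - (qq ^ 2 + 1 + (qq⁻¹) ^ 2) • (Bo c ^ 2 * Bi c * Bo c)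
    + (qq ^ 2 + 1 + (qq⁻¹) ^ 2) • (Bo c * Bi c * Bo c ^ 2) - Bi c * Bo c ^ 3
    = (-(qq * c * (qq + qq⁻¹) ^ 2)) • (Bo c * Bi c - Bi c * Bo c) := by
  have h := RingQuot.mkAlgHom_rel KK (qOnsRel.r0 (c := c))
  simp only [map_sub, map_add, map_smul, map_mul, map_pow] at h
  exact h

section rel
variable {K A : Type*} [Field K] [Ring A] [Algebra K A]

theorem rel_ad (q c : K) (hq : q ≠ 0) (hc : c ≠ 0) (h2 : q + q⁻¹ ≠ 0) (x z t D : A)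
    (hD : D = -(x * z) + (q⁻¹ ^ 2) • (z * x))
    (ht : t = (q ^ 2 * (q + q⁻¹) * c)⁻¹ •
      (z * x ^ 2 - (q * (q + q⁻¹)) • (x * z * x) + q ^ 2 • (x ^ 2 * z)) + z) :
    D * x - x * D = (-((q + q⁻¹) * c)) • (z - t) := by
  have h3 : q ^ 2 + 1 ≠ 0 := by
    intro h
    apply h2
    field_simp
    rw [h, mul_zero]
  subst hD ht
  simp only [pow_two x, add_mul, mul_add, neg_mul, mul_neg, smul_mul_assoc, mul_smul_comm, mul_assoc]
  match_scalars <;> field_simp <;> ring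

theorem rel_D (q c : K) (hq : q ≠ 0) (hc : c ≠ 0) (h2 : q + q⁻¹ ≠ 0) (x z t : A)
    (hDG : x ^ 3 * z - (q ^ 2 + 1 + (q⁻¹) ^ 2) • (x ^ 2 * z * x)
      + (q ^ 2 + 1 + (q⁻¹) ^ 2) • (x * z * x ^ 2) - z * x ^ 3
      = (-(q * c * (q + q⁻¹) ^ 2)) • (x * z - z * x))
    (ht : t = (q ^ 2 * (q + q⁻¹) * c)⁻¹ •
      (z * x ^ 2 - (q * (q + q⁻¹)) • (x * z * x) + q ^ 2 • (x ^ 2 * z)) + z) :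
    -(t * x) + (q⁻¹ ^ 2) • (x * t) = -(x * z) + (q⁻¹ ^ 2) • (z * x) := by
  have h3 : q ^ 2 + 1 ≠ 0 := by
    intro h
    apply h2
    field_simp
    rw [h, mul_zero]
  subst ht
  simp only [pow_succ x, pow_zero, one_mul, add_mul, mul_add, sub_mul, mul_sub, neg_mul, mul_neg,
    smul_mul_assoc, mul_smul_comm, mul_assoc] at hDG ⊢
  rw [← sub_eq_zero] at hDG ⊢
  have h4 := congrArg (fun r : A => (-(q ^ 2 * (q + q⁻¹) * c)⁻¹ * q⁻¹ ^ 2 * (-q ^ 2)) • r) hDG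
  simp only [smul_zero] at h4
  refine Eq.trans ?_ h4
  match_scalars <;> field_simp <;> ring

end rel

/-- The shifted real root vectors. -/
def yy (c : KK) (Φ T0 : QOns c ≃ₐ[KK] QOns c) : ℕ → QOns c
  | 0 => Bo c
  | n + 1 => Ba1 c Φ T0 n

theorem CC_eq (c : KK) (Φ T0 : QOns c ≃ₐ[KK] QOns c) (m : ℕ) :
    CC c Φ T0 m = SS (yy c Φ T0) 1 (m - 1) := by
  rw [SS_eq_sum, CC]
  refine Finset.sum_congr rfl fun p _ => ?_
  rw [add_comm 1 p, add_comm 1 (m - 1 - 1 - p), Nat.sub_sub m 1 1]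
  rfl

theorem Bim_eq (c : KK) (Φ T0 : QOns c ≃ₐ[KK] QOns c) (m : ℕ) :
    Bim c Φ T0 (m + 1) = GG (qq⁻¹ ^ 2) (yy c Φ T0) 0 m := by
  rw [Bim, GG, CC_eq, Nat.add_sub_cancel, Nat.zero_add, Nat.zero_add]
  rfl

/-- The ordered expression of `C_m`. -/
theorem stmt11 (c : KK) (hc : c ≠ 0) (Φ T0 : QOns c ≃ₐ[KK] QOns c)
    (hΦ0 : Φ (Bo c) = Bi c) (hΦ1 : Φ (Bi c) = Bo c)
    (hT00 : T0 (Bo c) = Bo c) (hT01 : T0 (Bi c) = T0B1val c)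
    (n : ℕ) (hn : 1 ≤ n)
    (hcom : ∀ k, 1 ≤ k → k < n → Bdel c * Bim c Φ T0 (k) - Bim c Φ T0 (k) * Bdel c = 0) :
    ∀ m : ℕ, 1 ≤ m → m ≤ n + 2 →
      CC c Φ T0 (m) =
        -(∑ p ∈ Finset.Icc 1 ((m - 1) / 2), (qq⁻¹) ^ (2 * (p - 1)) • Bim c Φ T0 (m - 2 * p))
        + ∑ p ∈ Finset.Icc 1 (m / 2),
            (if 2 * p = m then (qq⁻¹) ^ (m - 2) else (qq⁻¹) ^ (2 * (p - 1)) * (1 + (qq⁻¹) ^ 2)) • (Ba1 c Φ T0 (m - p - 1) * Ba1 c Φ T0 (p - 1)) := by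
  have hq := qq_ne_zero
  have hq2 := qq_add_inv_ne_zero
  let g : QOns c →ₐ[KK] QOns c := ((T1def c Φ T0).symm : QOns c →ₐ[KK] QOns c).comp (Φ : QOns c →ₐ[KK] QOns c)
  have hgdef : ∀ x, g x = (T1def c Φ T0).symm (Φ x) := fun _ => rfl
  have hginv : ∀ x, g (T0 (Φ x)) = x := by
    intro x
    rw [hgdef, AlgEquiv.symm_apply_eq]
    rfl
  have hg : ∀ k, g (yy c Φ T0 k) = yy c Φ T0 (k + 1) := by
    intro k
    cases k with
    | zero =>
      have := hginv (Bi c)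
      rw [hΦ1, hT00] at this
      exact this
    | succ k =>
      change g (Ba1 c Φ T0 k) = Ba1 c Φ T0 (k + 1)
      unfold Ba1
      rw [Function.iterate_succ_apply']
      rfl
  have hy0 : yy c Φ T0 0 = Bo c := rfl
  have hy1 : yy c Φ T0 1 = Bi c := rfl
  have hgt : g (T0B1val c) = Bo c := by
    have := hginv (Bo c)
    rwa [hΦ0, hT01] at this
  have hD : GG (qq⁻¹ ^ 2) (yy c Φ T0) 0 0 = Bdel c := by
    simp [GG, SS, hy0, hy1, Bdel]
  have hgD : g (Bdel c) = Bdel c := by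
    have e := rel_D qq c hq hc hq2 (Bo c) (Bi c) (T0B1val c) (DG0 c) rfl
    have e' := congrArg g e
    have h0 := hg 0
    rw [hy0, zero_add, hy1] at h0
    simp only [map_add, map_neg, map_mul, map_smul, hgt, h0] at e'
    rw [Bdel]
    simp only [map_add, map_neg, map_mul, map_smul, h0]
    exact e'.symm
  have hl : -((qq + qq⁻¹) * c) ≠ 0 := neg_ne_zero.mpr (mul_ne_zero hq2 hc)
  have had : ∀ k, Bdel c * yy c Φ T0 (k + 1) - yy c Φ T0 (k + 1) * Bdel c
      = (-((qq + qq⁻¹) * c)) • (yy c Φ T0 (k + 2) - yy c Φ T0 k) := by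
    intro k
    induction k with
    | zero =>
      have e := rel_ad qq c hq hc hq2 (Bo c) (Bi c) (T0B1val c) (Bdel c) rfl rfl
      have e' := congrArg g e
      rw [map_sub, map_mul, map_mul, map_smul, map_sub, hgt, hgD, ← hy0, ← hy1, hg, hg] at e'
      exact e'
    | succ k ih =>
      have e' := congrArg g ih
      rw [map_sub, map_mul, map_mul, map_smul, map_sub, hgD, hg, hg, hg] at e'
      exact e'
  have hinv := GG_inv (qq⁻¹ ^ 2) g (Bdel c) _ hl (yy c Φ T0) hg hD hgD had n (by
    intro k hk
    rw [← Bim_eq]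
    exact hcom (k + 1) (by omega) hk)
  intro m hm1 hm
  obtain ⟨m, rfl⟩ : ∃ k, m = k + 1 := ⟨m - 1, by omega⟩
  have key := SS_ordered qq⁻¹ (yy c Φ T0) n hinv m (by omega) 0
  rw [CC_eq, Nat.add_sub_cancel]
  have hsum : ∀ (f : ℕ → QOns c) (k : ℕ), ∑ p ∈ Finset.Icc 1 k, f p
      = ∑ i ∈ Finset.range k, f (i + 1) := by
    intro f k
    rw [Finset.range_eq_Ico, Finset.sum_Ico_add' f 0 k 1]
    rfl
  rw [hsum, hsum]
  refine key.trans ?_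
  congr 1
  · congr 1
    refine Finset.sum_congr rfl fun i hi => ?_
    rw [Finset.mem_range] at hi
    rw [show m + 1 - 2 * (i + 1) = (m - 2 * i - 2) + 1 by omega, Bim_eq, Nat.add_sub_cancel]
  · refine Finset.sum_congr rfl fun i hi => ?_
    rw [Finset.mem_range] at hi
    rw [show 0 + m - i = (m - i - 1) + 1 by omega, show m + 1 - (i + 1) - 1 = m - i - 1 by omega,
      Nat.add_sub_cancel, Nat.zero_add, show m + 1 - 2 = m - 1 by omega]
    have hiff : (2 * (i + 1) = m + 1) ↔ (2 * i + 1 = m) := by omega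
    simp only [hiff]
    rfl

end
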